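/- arXiv:2109.00935 — 2 statements merged into one kernel-verified Lean document; each statement's English description precedes it below -/
import Mathlib

section
/- Let K be a field, U a K-vector space, and G ⊆ U a subspace of dimension 2n. Suppose Ω and Ω′ are elements of ⋀²U lying in the span of elements g ∧ u with g ∈ G and u ∈ U, and suppose η and η′ lie in the image of ⋀²G in ⋀²U (i.e. in the span of g₁ ∧ g₂ with g₁, g₂ ∈ G). Then (Ω + η)^n ∧ (Ω′ + η′)^n = Ω^n ∧ Ω′^n in ⋀U. -/
open ExteriorAlgebra in
/-- The left ideal of the exterior algebra generated by a subspace of vectors is also closed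
under left multiplication. -/
theorem ExteriorAlgebra.top_mul_map_ι_mul_top_le {K U : Type*} [Field K] [AddCommGroup U]
    [Module K U] (G : Submodule K U) :
    (⊤ : Submodule K (ExteriorAlgebra K U)) * (G.map (ι K) * ⊤) ≤ G.map (ι K) * ⊤ := by
  rw [Submodule.mul_le]
  intro x _
  induction x using ExteriorAlgebra.induction with
  | algebraMap r =>
    intro z hz
    rw [← Algebra.smul_def]
    exact Submodule.smul_mem _ r hz
  | ι u =>
    intro z hz
    induction hz using Submodule.mul_induction_on' with
    | mem_mul_mem a ha t _ =>
      obtain ⟨g, hg, rfl⟩ := ha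
      rw [← mul_assoc, eq_neg_of_add_eq_zero_left (ι_add_mul_swap (R := K) u g), neg_mul,
        mul_assoc]
      exact Submodule.neg_mem _
        (Submodule.mul_mem_mul (Submodule.mem_map_of_mem hg) Submodule.mem_top)
    | add a _ b _ ha hb =>
      rw [mul_add]
      exact Submodule.add_mem _ ha hb
  | mul x y hx hy =>
    intro z hz
    rw [mul_assoc]
    exact hx Submodule.mem_top _ (hy Submodule.mem_top z hz)
  | add x y hx hy =>
    intro z hz
    rw [add_mul]
    exact Submodule.add_mem _ (hx Submodule.mem_top z hz) (hy Submodule.mem_top z hz)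

/-- If `A * ⊤` is a two-sided ideal, then the ideals `A ^ k * ⊤` form a multiplicative
filtration. -/
theorem Submodule.pow_mul_top_mul_pow_mul_top_le {K R : Type*} [CommSemiring K] [Semiring R]
    [Algebra K R] {A : Submodule K R} (hA : ⊤ * (A * ⊤) ≤ A * ⊤) (j k : ℕ) :
    (A ^ j * ⊤) * (A ^ k * ⊤) ≤ A ^ (j + k) * ⊤ := by
  have key : ⊤ * (A ^ k * ⊤) ≤ A ^ k * ⊤ := by
    induction k with
    | zero => simp
    | succ k ih =>
      calc ⊤ * (A ^ (k + 1) * ⊤) ≤ ⊤ * (A * ⊤) * (A ^ k * ⊤) := by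
            rw [pow_succ', mul_assoc A, mul_assoc ⊤, mul_assoc A]
            refine mul_le_mul_right (mul_le_mul_right ?_ _) _
            calc A ^ k * ⊤ = 1 * (A ^ k * ⊤) := (one_mul _).symm
              _ ≤ ⊤ * (A ^ k * ⊤) := mul_le_mul_left le_top _
        _ ≤ A * ⊤ * (A ^ k * ⊤) := mul_le_mul_left hA _
        _ ≤ A ^ (k + 1) * ⊤ := by
            rw [pow_succ', mul_assoc, mul_assoc]
            exact mul_le_mul_right ih _
  rw [pow_add, mul_assoc, mul_assoc]
  exact mul_le_mul_right key _

/-- Products of more than `finrank K G` vectors of `G` vanish in the exterior algebra. -/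
theorem ExteriorAlgebra.map_ι_pow_eq_bot {K U : Type*} [Field K] [AddCommGroup U]
    [Module K U] (G : Submodule K U) [Module.Finite K G] {k : ℕ}
    (hk : Module.finrank K G < k) : (G.map (ExteriorAlgebra.ι K)) ^ k = ⊥ := by
  have hG : G.map (ExteriorAlgebra.ι K) = (LinearMap.range (ExteriorAlgebra.ι K (M := G))).map
      (ExteriorAlgebra.map G.subtype).toLinearMap := by
    rw [← LinearMap.range_comp, ExteriorAlgebra.map_comp_ι, LinearMap.range_comp,
      Submodule.range_subtype]
  have h0 : (⋀[K]^k G) = ⊥ := by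
    rw [← Submodule.finrank_eq_zero (R := K), exteriorPower.finrank_eq,
      Nat.choose_eq_zero_of_lt hk]
  rw [hG, ← Submodule.map_pow]
  exact (congrArg _ h0).trans (Submodule.map_bot _)

/-- Perturbing an element of filtration degree one by one of degree two changes its `n`-th
power only in filtration degree `n + 1`. -/
theorem Submodule.add_pow_sub_pow_mem {K R : Type*} [CommRing K] [Ring R]
    [Algebra K R] {F : ℕ → Submodule K R} (h0 : 1 ∈ F 0)
    (hF : ∀ j k, F j * F k ≤ F (j + k)) {x y : R} (hx : x ∈ F 1) (hxy : x + y ∈ F 1)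
    (hy : y ∈ F 2) (n : ℕ) :
    x ^ n ∈ F n ∧ (x + y) ^ n ∈ F n ∧ (x + y) ^ n - x ^ n ∈ F (n + 1) := by
  induction n with
  | zero => simpa using h0
  | succ n ih =>
    obtain ⟨h1, h2, h3⟩ := ih
    refine ⟨?_, ?_, ?_⟩
    · rw [pow_succ]
      exact hF _ _ (Submodule.mul_mem_mul h1 hx)
    · rw [pow_succ]
      exact hF _ _ (Submodule.mul_mem_mul h2 hxy)
    · have h : (x + y) ^ (n + 1) - x ^ (n + 1) =
          ((x + y) ^ n - x ^ n) * (x + y) + x ^ n * y := by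
        rw [pow_succ, pow_succ]
        noncomm_ring
      rw [h]
      exact Submodule.add_mem _ (hF _ _ (Submodule.mul_mem_mul h3 hxy))
        (hF n 2 (Submodule.mul_mem_mul h1 hy))

/-- Let `G ⊆ U` be a subspace of dimension `2n`. If `Ω, Ω'` lie in the span of elements
`g ∧ u` with `g ∈ G`, `u ∈ U`, and `η, η'` lie in the image of `⋀²G` in `⋀²U` (the span of
`g₁ ∧ g₂` with `g₁, g₂ ∈ G`), then `(Ω + η)^n ∧ (Ω' + η')^n = Ω^n ∧ Ω'^n`. -/
theorem stmt3 (K : Type*) [Field K] (U : Type*) [AddCommGroup U] [Module K U]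
    (G : Submodule K U) (n : ℕ) (hG : Module.finrank K G = 2 * n)
    (Ω Ω' η η' : ExteriorAlgebra K U)
    (hΩ : Ω ∈ G.map (ExteriorAlgebra.ι K) *
      ((⊤ : Submodule K U).map (ExteriorAlgebra.ι K)))
    (hΩ' : Ω' ∈ G.map (ExteriorAlgebra.ι K) *
      ((⊤ : Submodule K U).map (ExteriorAlgebra.ι K)))
    (hη : η ∈ G.map (ExteriorAlgebra.ι K) * G.map (ExteriorAlgebra.ι K))
    (hη' : η' ∈ G.map (ExteriorAlgebra.ι K) * G.map (ExteriorAlgebra.ι K)) :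
    (Ω + η) ^ n * (Ω' + η') ^ n = Ω ^ n * Ω' ^ n := by
  rcases Nat.eq_zero_or_pos n with rfl | hn
  · simp
  have : Module.Finite K G := Module.finite_of_finrank_pos (by omega)
  set A := G.map (ExteriorAlgebra.ι K)
  have hA := ExteriorAlgebra.top_mul_map_ι_mul_top_le G
  let F : ℕ → Submodule K (ExteriorAlgebra K U) := fun k => A ^ k * ⊤
  have hF : ∀ j k, F j * F k ≤ F (j + k) := Submodule.pow_mul_top_mul_pow_mul_top_le hA
  have h0 : 1 ∈ F 0 := by simp [F]
  have hbot : F (n + n + 1) = ⊥ := by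
    simp only [F, A]
    rw [ExteriorAlgebra.map_ι_pow_eq_bot G (by omega), Submodule.bot_mul]
  have hone : A * (⊤ : Submodule K U).map (ExteriorAlgebra.ι K) ≤ F 1 := by
    simp only [F, pow_one]
    exact mul_le_mul_right le_top _
  have htwo : A * A ≤ F 2 := by
    simp only [F, pow_two]
    calc A * A = A * A * 1 := (mul_one _).symm
      _ ≤ A * A * ⊤ := mul_le_mul_right le_top _
  have hsub : A * A ≤ A * (⊤ : Submodule K U).map (ExteriorAlgebra.ι K) :=
    mul_le_mul_right (Submodule.map_mono le_top) _
  obtain ⟨h1, -, h3⟩ := Submodule.add_pow_sub_pow_mem h0 hF (hone hΩ)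
    (hone (Submodule.add_mem _ hΩ (hsub hη))) (htwo hη) n
  obtain ⟨-, h2', h3'⟩ := Submodule.add_pow_sub_pow_mem h0 hF (hone hΩ')
    (hone (Submodule.add_mem _ hΩ' (hsub hη'))) (htwo hη') n
  have e1 : ((Ω + η) ^ n - Ω ^ n) * (Ω' + η') ^ n = 0 := by
    have h := hF _ _ (Submodule.mul_mem_mul h3 h2')
    rwa [show n + 1 + n = n + n + 1 by omega, hbot, Submodule.mem_bot] at h
  have e2 : Ω ^ n * ((Ω' + η') ^ n - Ω' ^ n) = 0 := by
    have h := hF _ _ (Submodule.mul_mem_mul h1 h3')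
    rwa [← add_assoc, hbot, Submodule.mem_bot] at h
  rw [sub_mul, sub_eq_zero] at e1
  rw [mul_sub, sub_eq_zero] at e2
  exact e1.trans e2
end

section
/- Let n ≥ 1, let V be a real vector space of dimension 4n, and let Ω : V × V → ℂ be an ℝ-bilinear alternating complex-valued form satisfying Ω^(n+1) = 0 and Ω^n ∧ conj(Ω)^n ≠ 0. Let Ω also denote the ℂ-bilinear extension of Ω to the complexification V_ℂ = ℂ ⊗_ℝ V, let σ : V_ℂ → V_ℂ be the conjugation map (complex conjugation on the first tensor factor), and let K = { v ∈ V_ℂ : Ω(v, w) = 0 for all w ∈ V_ℂ }. Then K has complex dimension 2n and V_ℂ = K ⊕ σ(K). -/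
open TensorProduct Module

/-- The wedge product `F 0 ∧ F 1 ∧ ⋯ ∧ F (m-1)` of a family of complex-valued 2-forms on `V`,
as an (unnormalized) alternating `2m`-linear map: the signed sum over all permutations of the
products of the values of the `F i` on consecutive pairs of arguments. (This differs from the
usual wedge product only by the nonzero constant `2^m · m!`.) -/
noncomputable def wedgePow {V : Type*} (m : ℕ) (F : Fin m → V → V → ℂ)
    (v : Fin (2 * m) → V) : ℂ :=
  ∑ σ : Equiv.Perm (Fin (2 * m)), ((Equiv.Perm.sign σ : ℤ) : ℂ) *
    ∏ i : Fin m, F i (v (σ ⟨2 * (i : ℕ), by omega⟩)) (v (σ ⟨2 * (i : ℕ) + 1, by omega⟩))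

/-- A permutation of `ι × β` that maps fibres over `ι` to fibres permutes the fibres and acts by a
permutation inside each of them. -/
lemma Equiv.Perm.exists_eq_prodCongrLeft_mul_prodCongrRight {ι β : Type*} [Finite ι] [Finite β]
    [Nonempty β] {τ : Equiv.Perm (ι × β)} (h : ∀ i a b, (τ (i, a)).1 = (τ (i, b)).1) :
    ∃ (π : Equiv.Perm ι) (t : ι → Equiv.Perm β),
      τ = Equiv.prodCongrLeft (fun _ => π) * Equiv.prodCongrRight t := by
  obtain ⟨b⟩ := ‹Nonempty β›
  have hπ : Function.Bijective fun i => (τ (i, b)).1 := by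
    refine Finite.injective_iff_bijective.1 (Finite.injective_iff_surjective.2 fun j => ?_)
    obtain ⟨⟨i, a⟩, hi⟩ := τ.surjective (j, b)
    exact ⟨i, by rw [h i b a, hi]⟩
  have ht (i : ι) : Function.Bijective fun a => (τ (i, a)).2 := by
    refine Finite.injective_iff_bijective.1 fun a c hac => ?_
    simpa using τ.injective (Prod.ext (h i a c) hac)
  refine ⟨.ofBijective _ hπ, fun i => .ofBijective _ (ht i), ?_⟩
  ext ⟨i, a⟩
  · simp [h i a b]
  · simp

section Wedge

variable {k W : Type*} [Field k] [AddCommGroup W] [Module k W] {ι : Type*} [Fintype ι]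
  [DecidableEq ι]

/-- The tensor product of a family of bilinear forms, as a multilinear form. -/
def pairProd (F : ι → W →ₗ[k] W →ₗ[k] k) : MultilinearMap k (fun _ : ι × Fin 2 => W) k where
  toFun v := ∏ i, F i (v (i, 0)) (v (i, 1))
  map_update_add' := by
    intro inst v p x y
    obtain rfl : inst = instDecidableEqProd := Subsingleton.elim _ _
    obtain ⟨j, a⟩ := p
    have h (z : W) : ∏ i ∈ Finset.univ.erase j, F i (Function.update v (j, a) z (i, 0))
        (Function.update v (j, a) z (i, 1)) =
        ∏ i ∈ Finset.univ.erase j, F i (v (i, 0)) (v (i, 1)) :=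
      Finset.prod_congr rfl fun i hi => by simp [Finset.ne_of_mem_erase hi]
    simp only [← Finset.mul_prod_erase Finset.univ _ (Finset.mem_univ j), h, ← add_mul]
    congr 1
    fin_cases a <;> simp
  map_update_smul' := by
    intro inst v p c x
    obtain rfl : inst = instDecidableEqProd := Subsingleton.elim _ _
    obtain ⟨j, a⟩ := p
    have h (z : W) : ∏ i ∈ Finset.univ.erase j, F i (Function.update v (j, a) z (i, 0))
        (Function.update v (j, a) z (i, 1)) =
        ∏ i ∈ Finset.univ.erase j, F i (v (i, 0)) (v (i, 1)) :=
      Finset.prod_congr rfl fun i hi => by simp [Finset.ne_of_mem_erase hi]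
    simp only [← Finset.mul_prod_erase Finset.univ _ (Finset.mem_univ j), h, smul_eq_mul,
      ← mul_assoc]
    congr 1
    fin_cases a <;> simp

/-- The wedge product of a family of bilinear forms, as an alternating form. -/
def pairWedge (F : ι → W →ₗ[k] W →ₗ[k] k) : W [⋀^(ι × Fin 2)]→ₗ[k] k :=
  MultilinearMap.alternatization (pairProd F)

lemma pairWedge_apply (F : ι → W →ₗ[k] W →ₗ[k] k) (v : ι × Fin 2 → W) :
    pairWedge F v = ∑ τ : Equiv.Perm (ι × Fin 2), ((Equiv.Perm.sign τ : ℤ) : k) *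
      ∏ i, F i (v (τ (i, 0))) (v (τ (i, 1))) := by
  simp [pairWedge, MultilinearMap.alternatization_apply, pairProd, Units.smul_def]

lemma pairWedge_eq_zero_of_apply_eq {F : ι → W →ₗ[k] W →ₗ[k] k} {x : W}
    (hl : ∀ i w, F i x w = 0) (hr : ∀ i w, F i w x = 0) {v : ι × Fin 2 → W} {p : ι × Fin 2}
    (hp : v p = x) : pairWedge F v = 0 := by
  rw [pairWedge_apply]
  refine Finset.sum_eq_zero fun τ _ => ?_
  rw [Finset.prod_eq_zero (Finset.mem_univ (τ.symm p).1), mul_zero]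
  obtain ⟨⟨i, a⟩, rfl⟩ := τ.surjective p
  rw [Equiv.symm_apply_apply]
  fin_cases a
  · exact hp ▸ hl _ _
  · exact hp ▸ hr _ _

/-- A top-degree alternating form whose contraction with a nonzero vector vanishes is zero. -/
lemma AlternatingMap.eq_zero_of_contraction_eq_zero [FiniteDimensional k W] {κ : Type*}
    [Fintype κ] [DecidableEq κ] (hκ : Fintype.card κ = finrank k W) (A : W [⋀^κ]→ₗ[k] k) {x : W} (hx : x ≠ 0)
    (hA : ∀ (v : κ → W) (p : κ), v p = x → A v = 0) : A = 0 := by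
  ext v
  by_cases hv : LinearIndependent k v
  · have : Nonempty κ := by
      rw [← Fintype.card_pos_iff, hκ]
      exact finrank_pos_iff_exists_ne_zero.2 ⟨x, hx⟩
    let e := basisOfLinearIndependentOfCardEqFinrank hv hκ
    have he : ⇑e = v := coe_basisOfLinearIndependentOfCardEqFinrank hv hκ
    obtain ⟨j, hj⟩ : ∃ j, e.repr x j ≠ 0 := by
      by_contra! h
      exact hx (e.repr.map_eq_zero_iff.1 (Finsupp.ext h))
    have h := hA (Function.update v j x) j (by simp)
    rw [← e.sum_repr x, he, A.map_update_sum, Finset.sum_eq_single j] at h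
    · simpa [hj] using h
    · intro i _ hi
      rw [A.map_update_smul, A.map_update_self _ hi.symm, smul_zero]
    · simp
  · simpa using A.map_linearDependent v hv

/-- The top power of a form on orthogonal hyperbolic pairs is nonzero: every term of its value at
those pairs is `0` or `1`. -/
lemma pairWedge_ne_zero_of_hyperbolic [CharZero k] {B : W →ₗ[k] W →ₗ[k] k} (hB : B.IsAlt)
    {e f : ι → W} (hee : ∀ i j, B (e i) (e j) = 0) (hff : ∀ i j, B (f i) (f j) = 0)
    (hef : ∀ i j, B (e i) (f j) = if i = j then 1 else 0) :
    pairWedge (fun _ : ι => B) ≠ 0 := by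
  intro h0
  let v : ι × Fin 2 → W := fun p => ![e p.1, f p.1] p.2
  have hfe (i j) : B (f i) (e j) = if i = j then -1 else 0 := by
    rw [← hB.neg, hef]; split_ifs <;> simp_all
  have hv (i j : ι) (hij : i ≠ j) (a b : Fin 2) : B (v (i, a)) (v (j, b)) = 0 := by
    fin_cases a <;> fin_cases b <;> simp [v, hee, hff, hef, hfe, hij]
  have hperm (t : Equiv.Perm (Fin 2)) (i : ι) :
      B (v (i, t 0)) (v (i, t 1)) = ((Equiv.Perm.sign t : ℤ) : k) := by
    have : t = 1 ∨ t = Equiv.swap 0 1 := by revert t; decide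
    rcases this with rfl | rfl <;> simp [v, hef, hfe]
  have hterm (τ : Equiv.Perm (ι × Fin 2)) : ((Equiv.Perm.sign τ : ℤ) : k) *
      ∏ i, B (v (τ (i, 0))) (v (τ (i, 1))) =
        if ∀ i, (τ (i, 0)).1 = (τ (i, 1)).1 then 1 else 0 := by
    split_ifs with hτ
    · obtain ⟨π, t, rfl⟩ := Equiv.Perm.exists_eq_prodCongrLeft_mul_prodCongrRight (τ := τ)
        (fun i a b => by fin_cases a <;> fin_cases b <;> simp [hτ])
      have ht (i : ι) :
          ((Equiv.Perm.sign (t i) : ℤ) : k) * ((Equiv.Perm.sign (t i) : ℤ) : k) = 1 := by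
        rw [← Int.cast_mul, ← Units.val_mul, Int.units_mul_self]; simp
      simp [Equiv.Perm.sign_prodCongrLeft, Equiv.Perm.sign_prodCongrRight, hperm,
        ← Finset.prod_mul_distrib, ht]
    · push Not at hτ
      obtain ⟨i, hi⟩ := hτ
      rw [Finset.prod_eq_zero (Finset.mem_univ i) (hv _ _ hi _ _), mul_zero]
  have hsum := congrArg (· v) h0
  simp only [pairWedge_apply, hterm, Finset.sum_boole, AlternatingMap.zero_apply,
    Nat.cast_eq_zero, Finset.card_eq_zero, Finset.filter_eq_empty_iff] at hsum
  exact hsum (Finset.mem_univ 1) fun _ => rfl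

/-- An alternating form of rank greater than `2 * m - 2` admits `m` orthogonal hyperbolic
pairs. -/
lemma LinearMap.IsAlt.exists_hyperbolic [FiniteDimensional k W] {B : W →ₗ[k] W →ₗ[k] k}
    (hB : B.IsAlt) (m : ℕ) (hm : finrank k (LinearMap.ker B) + 2 * m < finrank k W + 2) :
    ∃ e f : Fin m → W, (∀ i j, B (e i) (e j) = 0) ∧ (∀ i j, B (f i) (f j) = 0) ∧
      ∀ i j, B (e i) (f j) = if i = j then 1 else 0 := by
  induction m with
  | zero => exact ⟨Fin.elim0, Fin.elim0, by simp⟩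
  | succ m ih =>
    obtain ⟨e, f, hee, hff, hef⟩ := ih (by omega)
    have hfe (i j) : B (f i) (e j) = if i = j then -1 else 0 := by
      rw [← hB.neg, hef]; split_ifs <;> simp_all
    let φ : W →ₗ[k] (Fin m → k) × (Fin m → k) :=
      (LinearMap.pi fun i => B (e i)).prod (LinearMap.pi fun i => B (f i))
    have hφ (w : W) : w ∈ LinearMap.ker φ ↔ ∀ i, B (e i) w = 0 ∧ B (f i) w = 0 := by
      simp [φ, funext_iff, forall_and]
    obtain ⟨u, hu, v, hv, huv⟩ : ∃ u ∈ LinearMap.ker φ, ∃ v ∈ LinearMap.ker φ, B u v ≠ 0 := by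
      by_contra! H
      have hle : LinearMap.ker φ ≤ LinearMap.ker B := by
        intro u hu
        refine LinearMap.mem_ker.2 (LinearMap.ext fun w => ?_)
        have hu' := (hφ u).1 hu
        have hu1 (i) : B u (e i) = 0 := by rw [← hB.neg, (hu' i).1, neg_zero]
        have hu2 (i) : B u (f i) = 0 := by rw [← hB.neg, (hu' i).2, neg_zero]
        have := H u hu (w + ∑ i, (B (f i) w • e i - B (e i) w • f i)) <| by
          rw [hφ]
          intro i
          simp [hee, hff, hef, hfe]
        simpa [hu1, hu2] using this
      have h1 := Submodule.finrank_mono hle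
      have h2 := φ.finrank_range_add_finrank_ker
      have h3 := Submodule.finrank_le (LinearMap.range φ)
      simp only [finrank_prod, finrank_fintype_fun_eq_card, Fintype.card_fin] at h3
      omega
    have hu' := (hφ u).1 hu
    have hv' := (hφ v).1 hv
    have hu1 (i) : B u (e i) = 0 := by rw [← hB.neg, (hu' i).1, neg_zero]
    have hu2 (i) : B u (f i) = 0 := by rw [← hB.neg, (hu' i).2, neg_zero]
    have hv2 (i) : B v (f i) = 0 := by rw [← hB.neg, (hv' i).2, neg_zero]
    refine ⟨Fin.cons u e, Fin.cons ((B u v)⁻¹ • v) f, ?_, ?_, ?_⟩ <;> intro i j <;>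
      refine Fin.cases ?_ (fun i => ?_) i <;> refine Fin.cases ?_ (fun j => ?_) j <;>
      simp [hee, hff, hef, hu', hv', hu1, hu2, hv2, hB.self_eq_zero, huv, Fin.succ_ne_zero,
        (Fin.succ_ne_zero _).symm]

/-- If `B ^ (m + 1) = 0`, then `B` has rank at most `2 * m`. -/
lemma LinearMap.IsAlt.finrank_le_of_pairWedge_eq_zero [CharZero k] [FiniteDimensional k W]
    {B : W →ₗ[k] W →ₗ[k] k} (hB : B.IsAlt) {m : ℕ}
    (h : pairWedge (fun _ : Fin (m + 1) => B) = 0) :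
    finrank k W ≤ finrank k (LinearMap.ker B) + 2 * m := by
  by_contra! hlt
  obtain ⟨e, f, hee, hff, hef⟩ := hB.exists_hyperbolic (m + 1) (by omega)
  exact pairWedge_ne_zero_of_hyperbolic hB hee hff hef h

end Wedge

/-- The bijection `(i, a) ↦ 2 * i + a`. -/
def pairIndex (m : ℕ) : Fin m × Fin 2 ≃ Fin (2 * m) :=
  finProdFinEquiv.trans (finCongr (mul_comm m 2))

lemma wedgePow_eq_pairWedge {V W : Type*} [AddCommGroup W] [Module ℂ W] (m : ℕ)
    (F : Fin m → V → V → ℂ) (G : Fin m → W →ₗ[ℂ] W →ₗ[ℂ] ℂ) (g : V → W)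
    (hG : ∀ i u v, G i (g u) (g v) = F i u v) (v : Fin (2 * m) → V) :
    wedgePow m F v = pairWedge G (g ∘ v ∘ pairIndex m) := by
  rw [wedgePow, pairWedge_apply]
  refine (Fintype.sum_equiv (pairIndex m).permCongr _ _ fun τ => ?_).symm
  rw [Equiv.Perm.sign_permCongr]
  congr 1
  refine Finset.prod_congr rfl fun i _ => ?_
  have h0 : (⟨2 * (i : ℕ), by omega⟩ : Fin (2 * m)) = pairIndex m (i, 0) := by
    ext; simp [pairIndex]
  have h1 : (⟨2 * (i : ℕ) + 1, by omega⟩ : Fin (2 * m)) = pairIndex m (i, 1) := by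
    ext; simp [pairIndex, add_comm]
  rw [h0, h1]
  simp [Equiv.permCongr_apply, hG]

/-- Let `V` be a real vector space of dimension `4n` and `Ω` an ℝ-bilinear alternating
complex-valued form on `V` with `Ω^(n+1) = 0` and `Ω^n ∧ conj(Ω)^n ≠ 0` (C-symplectic).
Let `Ωc` be the ℂ-bilinear extension of `Ω` to the complexification `V_ℂ = ℂ ⊗_ℝ V`,
`σc` the conjugation of `V_ℂ`, and `K = ker Ωc = {v : Ωc(v, ·) = 0}`. Then
`dim_ℂ K = 2n` and `V_ℂ = K ⊕ σc(K)`. -/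
theorem stmt7 (n : ℕ) (hn : 1 ≤ n) (V : Type*) [AddCommGroup V] [Module ℝ V]
    [FiniteDimensional ℝ V] (hdim : finrank ℝ V = 4 * n)
    (Ω : V →ₗ[ℝ] V →ₗ[ℝ] ℂ) (halt : ∀ v : V, Ω v v = 0)
    (hpow : wedgePow (n + 1) (fun _ u v => Ω u v) = 0)
    (hnz : wedgePow (2 * n)
      (fun i u v => if (i : ℕ) < n then Ω u v else (starRingEnd ℂ) (Ω u v)) ≠ 0)
    (Ωc : (ℂ ⊗[ℝ] V) →ₗ[ℂ] (ℂ ⊗[ℝ] V) →ₗ[ℂ] ℂ)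
    (hΩc : ∀ u v : V, Ωc ((1 : ℂ) ⊗ₜ[ℝ] u) ((1 : ℂ) ⊗ₜ[ℝ] v) = Ω u v)
    (σc : (ℂ ⊗[ℝ] V) →ₗ[ℝ] (ℂ ⊗[ℝ] V))
    (hσc : ∀ (z : ℂ) (v : V), σc (z ⊗ₜ[ℝ] v) = (starRingEnd ℂ z) ⊗ₜ[ℝ] v) :
    finrank ℂ (LinearMap.ker Ωc) = 2 * n ∧
      IsCompl ((LinearMap.ker Ωc).restrictScalars ℝ)
        (Submodule.map σc ((LinearMap.ker Ωc).restrictScalars ℝ)) := by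
  have hfin : finrank ℂ (ℂ ⊗[ℝ] V) = 4 * n := by rw [Module.finrank_baseChange, hdim]
  have htmul (z : ℂ) (v : V) : z ⊗ₜ[ℝ] v = z • ((1 : ℂ) ⊗ₜ[ℝ] v) := by
    rw [TensorProduct.smul_tmul', smul_eq_mul, mul_one]
  have hneg (x y : ℂ ⊗[ℝ] V) : Ωc x y = -Ωc y x := by
    have hΩ (u v : V) : Ω u v = -Ω v u := (LinearMap.IsAlt.neg (B := Ω) halt v u).symm
    induction x with
    | zero => simp
    | add x₁ x₂ h₁ h₂ => simp only [map_add, LinearMap.add_apply, h₁, h₂, neg_add]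
    | tmul z u =>
      induction y with
      | zero => simp
      | add y₁ y₂ h₁ h₂ => simp only [map_add, LinearMap.add_apply, h₁, h₂, neg_add]
      | tmul w v =>
        rw [htmul z, htmul w]
        simp only [map_smul, LinearMap.smul_apply, hΩc, smul_eq_mul]
        rw [hΩ u v]
        ring
  have hAlt : Ωc.IsAlt := fun x => self_eq_neg.1 (hneg x x)
  have hσσ (x : ℂ ⊗[ℝ] V) : σc (σc x) = x := by
    induction x with
    | zero => simp
    | add x y hx hy => rw [map_add, map_add, hx, hy]
    | tmul z v => simp [hσc]
  have hσsmul (c : ℂ) (x : ℂ ⊗[ℝ] V) : σc (c • x) = starRingEnd ℂ c • σc x := by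
    induction x with
    | zero => simp
    | add x y hx hy => rw [smul_add, map_add, hx, hy, map_add, smul_add]
    | tmul z v => simp [hσc, TensorProduct.smul_tmul']
  let Ωbar : (ℂ ⊗[ℝ] V) →ₗ[ℂ] (ℂ ⊗[ℝ] V) →ₗ[ℂ] ℂ :=
    LinearMap.mk₂ ℂ (fun x y => starRingEnd ℂ (Ωc (σc x) (σc y)))
      (by simp) (by simp [hσsmul]) (by simp) (by simp [hσsmul])
  have hΩbar (x y) : Ωbar x y = starRingEnd ℂ (Ωc (σc x) (σc y)) := rfl
  have hge : 4 * n ≤ finrank ℂ (LinearMap.ker Ωc) + 2 * n := by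
    rw [← hfin]
    refine hAlt.finrank_le_of_pairWedge_eq_zero ?_
    let b := Algebra.TensorProduct.basis ℂ (Module.finBasis ℝ V)
    refine AlternatingMap.coe_multilinearMap_injective
      (Module.Basis.ext_multilinear (fun _ => b) fun j => ?_)
    have h := congrFun hpow fun i => Module.finBasis ℝ V (j ((pairIndex (n + 1)).symm i))
    rw [wedgePow_eq_pairWedge (n + 1) _ (fun _ => Ωc) (fun v => (1 : ℂ) ⊗ₜ[ℝ] v)
      (fun _ => hΩc)] at h
    simpa [b, Function.comp_def] using h
  have hdisj : Disjoint ((LinearMap.ker Ωc).restrictScalars ℝ)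
      (Submodule.map σc ((LinearMap.ker Ωc).restrictScalars ℝ)) := by
    rw [Submodule.disjoint_def]
    rintro x hx ⟨y, hy, rfl⟩
    by_contra hne
    have hx' (w) : Ωc (σc y) w = 0 := by
      rw [LinearMap.mem_ker.1 ((Submodule.restrictScalars_mem ..).1 hx), LinearMap.zero_apply]
    have hy' (w) : Ωc y w = 0 := by
      rw [LinearMap.mem_ker.1 ((Submodule.restrictScalars_mem ..).1 hy), LinearMap.zero_apply]
    let G : Fin (2 * n) → (ℂ ⊗[ℝ] V) →ₗ[ℂ] (ℂ ⊗[ℝ] V) →ₗ[ℂ] ℂ :=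
      fun i => if (i : ℕ) < n then Ωc else Ωbar
    have hG : pairWedge G = 0 := by
      refine AlternatingMap.eq_zero_of_contraction_eq_zero ?_ _ hne fun v p hp =>
        pairWedge_eq_zero_of_apply_eq ?_ ?_ hp
      · simp [hfin]; ring
      · intro i w
        simp only [G]
        split_ifs
        · exact hx' w
        · rw [hΩbar, hσσ, hy', map_zero]
      · intro i w
        simp only [G]
        split_ifs
        · rw [hneg, hx', neg_zero]
        · rw [hΩbar, hσσ, hneg, hy', neg_zero, map_zero]
    refine hnz (funext fun v => ?_)
    rw [wedgePow_eq_pairWedge (2 * n) _ G (fun v => (1 : ℂ) ⊗ₜ[ℝ] v), hG]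
    · simp
    · intro i u v
      simp only [G]
      split_ifs
      · exact hΩc u v
      · simp [hΩbar, hσc, hΩc]
  have hfinR : finrank ℝ (ℂ ⊗[ℝ] V) = 2 * (4 * n) := by
    rw [← finrank_mul_finrank ℝ ℂ (ℂ ⊗[ℝ] V), Complex.finrank_real_complex, hfin]
  have hK : finrank ℝ ((LinearMap.ker Ωc).restrictScalars ℝ) =
      2 * finrank ℂ (LinearMap.ker Ωc) := finrank_real_of_complex (LinearMap.ker Ωc)
  have hσK : finrank ℝ (Submodule.map σc ((LinearMap.ker Ωc).restrictScalars ℝ)) =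
      2 * finrank ℂ (LinearMap.ker Ωc) := by
    rw [← hK]
    exact (LinearEquiv.ofInvolutive σc hσσ).finrank_map_eq _
  have hle := Submodule.finrank_add_finrank_le_of_disjoint hdisj
  refine ⟨by omega, (Submodule.isCompl_iff_disjoint _ _ (by omega)).2 hdisj⟩
end
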